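/- arXiv:hep-th/0605255 — 2 statements merged into one kernel-verified Lean document; each statement's English description precedes it below -/
import Mathlib

section
/- Let p₁, p₂, p₃ be three non-collinear points of the Euclidean plane ℝ² with d(p₁,p₂) = d(p₁,p₃) ≠ d(p₂,p₃) (an isosceles, non-equilateral triangle), and let T be the convex hull of {p₁, p₂, p₃}. Then the set of isometries of T, i.e. maps g : T → T satisfying d(g(x), g(y)) = d(x, y) for all x, y ∈ T, has exactly 2 elements. -/
open Submodule in
/-- Two points equidistant from `p` are swapped by an isometry fixing `p`. -/
theorem exists_affineIsometryEquiv_swap {E : Type*} [NormedAddCommGroup E] [InnerProductSpace ℝ E]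
    {p q r : E} (h : dist p q = dist p r) :
    ∃ F : E ≃ᵃⁱ[ℝ] E, F p = p ∧ F q = r ∧ F r = q := by
  set L := reflection (ℝ ∙ ((q - p) - (r - p)))ᗮ with hL
  have hn : ‖q - p‖ = ‖r - p‖ := by
    rwa [← dist_eq_norm, ← dist_eq_norm, dist_comm q, dist_comm r]
  have hqr : L (q - p) = r - p := reflection_sub hn
  have hrq : L (r - p) = q - p := by rw [← hqr, hL, reflection_reflection]
  refine ⟨((AffineIsometryEquiv.vaddConst ℝ p).symm.trans L.toAffineIsometryEquiv).trans
    (AffineIsometryEquiv.vaddConst ℝ p), ?_, ?_, ?_⟩ <;> simp [hqr, hrq]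

theorem mem_convexHull_triple {E : Type*} [AddCommGroup E] [Module ℝ E] {p q r x : E}
    (hx : x ∈ convexHull ℝ {p, q, r}) :
    ∃ s t : ℝ, 0 ≤ s ∧ 0 ≤ t ∧ s + t ≤ 1 ∧ x = p + s • (q - p) + t • (r - p) := by
  rw [convexHull_insert (Set.insert_nonempty _ _), convexHull_pair] at hx
  simp only [mem_convexJoin, Set.mem_singleton_iff, exists_eq_left] at hx
  obtain ⟨y, ⟨a, b, ha, hb, hab, rfl⟩, c, d, hc, hd, hcd, rfl⟩ := hx
  refine ⟨d * a, d * b, by positivity, by positivity, ?_, ?_⟩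
  · rw [← mul_add, hab]; linarith
  · obtain rfl : c = 1 - d := by linarith
    obtain rfl : b = 1 - a := by linarith
    module

/-- The squared length of `s • e + t • f` when `‖e‖ ^ 2 = ‖f‖ ^ 2 = A` and `‖e - f‖ ^ 2 = B`. -/
def isoscelesForm (A B s t : ℝ) : ℝ := A * (s + t) ^ 2 - B * (s * t)

theorem dist_sq_eq_isoscelesForm {E : Type*} [NormedAddCommGroup E] [InnerProductSpace ℝ E]
    {p q r : E} (h : dist p q = dist p r) (s t s' t' : ℝ) :
    dist (p + s • (q - p) + t • (r - p)) (p + s' • (q - p) + t' • (r - p)) ^ 2 =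
      isoscelesForm (dist p q ^ 2) (dist q r ^ 2) (s - s') (t - t') := by
  have hsub : (p + s • (q - p) + t • (r - p)) - (p + s' • (q - p) + t' • (r - p)) =
      (s - s') • (q - p) + (t - t') • (r - p) := by module
  have hqr : dist q r = ‖(q - p) - (r - p)‖ := by rw [dist_eq_norm]; congr 1; abel
  have hq : dist p q = ‖q - p‖ := by rw [dist_comm, dist_eq_norm]
  have hr : dist p q = ‖r - p‖ := by rw [h, dist_comm, dist_eq_norm]
  have hn : ‖r - p‖ = ‖q - p‖ := hr.symm.trans hq
  rw [dist_eq_norm, hsub, hqr, hq, norm_add_sq_real, norm_sub_sq_real (q - p), norm_smul, norm_smul,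
    real_inner_smul_left, real_inner_smul_right, mul_pow, mul_pow, Real.norm_eq_abs,
    Real.norm_eq_abs, sq_abs, sq_abs, hn, isoscelesForm]
  ring

theorem eq_of_isoscelesForm_eq {A B s t s' t' : ℝ} (hB : 0 < B) (hBA : B < 4 * A)
    (h₁ : isoscelesForm A B s t = isoscelesForm A B s' t')
    (h₂ : isoscelesForm A B (s - 1) t = isoscelesForm A B (s' - 1) t')
    (h₃ : isoscelesForm A B s (t - 1) = isoscelesForm A B s' (t' - 1)) : s = s' ∧ t = t' := by
  unfold isoscelesForm at h₁ h₂ h₃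
  have hd : s - t = s' - t' := mul_left_cancel₀ hB.ne' (by linear_combination h₃ - h₂)
  have hs : s + t = s' + t' := mul_left_cancel₀ (sub_pos.2 hBA).ne'
    (by linear_combination 2 * h₁ - h₂ - h₃)
  constructor <;> linarith

/-- When the base is the longest side, only its endpoints realise its length. -/
theorem endpoints_of_isoscelesForm_eq_base {A B s t s' t' : ℝ} (hA : 0 < A) (hAB : A < B)
    (hs : 0 ≤ s) (ht : 0 ≤ t) (hst : s + t ≤ 1) (hs' : 0 ≤ s') (ht' : 0 ≤ t') (hst' : s' + t' ≤ 1)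
    (h : isoscelesForm A B (s - s') (t - t') = B) :
    (s = 1 ∧ t = 0 ∧ s' = 0 ∧ t' = 1) ∨ (s = 0 ∧ t = 1 ∧ s' = 1 ∧ t' = 0) := by
  obtain ⟨u, hu⟩ : ∃ u, u = s - s' := ⟨_, rfl⟩
  obtain ⟨v, hv⟩ : ∃ v, v = t - t' := ⟨_, rfl⟩
  rw [← hu, ← hv, isoscelesForm] at h
  have hneg : u * v < 0 := by
    by_contra! hc
    have : (u + v) ^ 2 ≤ 1 := by rw [sq_le_one_iff_abs_le_one, abs_le]; constructor <;> linarith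
    nlinarith
  have hu1 : u ^ 2 ≤ 1 := by rw [sq_le_one_iff_abs_le_one, abs_le]; constructor <;> linarith
  have hv1 : v ^ 2 ≤ 1 := by rw [sq_le_one_iff_abs_le_one, abs_le]; constructor <;> linarith
  have hle : u ^ 2 + u * v + v ^ 2 ≤ 1 := by
    rcases mul_neg_iff.1 hneg with ⟨h1, h2⟩ | ⟨h1, h2⟩ <;>
    rcases le_total 0 (u + v) with h3 | h3 <;> nlinarith
  have h0 : (u + v) ^ 2 = 0 := by
    have h1 : (B - A) * (u + v) ^ 2 ≤ 0 := by nlinarith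
    have h2 := sq_nonneg (u + v)
    nlinarith [sub_pos.2 hAB]
  have hvu : v = -u := by have := pow_eq_zero_iff (two_ne_zero) |>.1 h0; linarith
  subst hvu
  have hu2 : u ^ 2 = 1 := mul_left_cancel₀ (hA.trans hAB).ne' (by linear_combination h)
  rcases eq_or_eq_neg_of_sq_eq_sq u 1 (by simpa using hu2) with h1 | h1
  · left; refine ⟨?_, ?_, ?_, ?_⟩ <;> linarith
  · right; refine ⟨?_, ?_, ?_, ?_⟩ <;> linarith

/-- When the legs are the longest sides, only their endpoints realise their length. -/
theorem endpoints_of_isoscelesForm_eq_leg {A B s t s' t' : ℝ} (hB : 0 < B) (hBA : B < A)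
    (hs : 0 ≤ s) (ht : 0 ≤ t) (hst : s + t ≤ 1) (hs' : 0 ≤ s') (ht' : 0 ≤ t') (hst' : s' + t' ≤ 1)
    (h : isoscelesForm A B (s - s') (t - t') = A) :
    (s = 0 ∧ t = 0 ∧ (s' = 1 ∧ t' = 0 ∨ s' = 0 ∧ t' = 1)) ∨
      (s' = 0 ∧ t' = 0 ∧ (s = 1 ∧ t = 0 ∨ s = 0 ∧ t = 1)) := by
  obtain ⟨u, hu⟩ : ∃ u, u = s - s' := ⟨_, rfl⟩
  obtain ⟨v, hv⟩ : ∃ v, v = t - t' := ⟨_, rfl⟩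
  rw [← hu, ← hv, isoscelesForm] at h
  have hw1 : (u + v) ^ 2 ≤ 1 := by
    rw [sq_le_one_iff_abs_le_one, abs_le]; constructor <;> linarith
  have hu1 : u ^ 2 ≤ 1 := by rw [sq_le_one_iff_abs_le_one, abs_le]; constructor <;> linarith
  have hv1 : v ^ 2 ≤ 1 := by rw [sq_le_one_iff_abs_le_one, abs_le]; constructor <;> linarith
  have hpos : 0 ≤ u * v := by
    by_contra! hneg
    have hle : u ^ 2 + u * v + v ^ 2 ≤ 1 := by
      rcases mul_neg_iff.1 hneg with ⟨h1, h2⟩ | ⟨h1, h2⟩ <;>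
      rcases le_total 0 (u + v) with h3 | h3 <;> nlinarith
    nlinarith
  have hw : (u + v) ^ 2 = 1 := by
    refine le_antisymm hw1 ?_
    by_contra! hc
    nlinarith [mul_nonneg hB.le hpos]
  have huv : u * v = 0 := by
    rw [hw] at h
    exact mul_left_cancel₀ hB.ne' (by linear_combination -h)
  rcases eq_or_eq_neg_of_sq_eq_sq (u + v) 1 (by simpa using hw) with h1 | h1 <;> rcases mul_eq_zero.1 huv with h2 | h2
  · right; refine ⟨?_, ?_, Or.inr ⟨?_, ?_⟩⟩ <;> linarith
  · right; refine ⟨?_, ?_, Or.inl ⟨?_, ?_⟩⟩ <;> linarith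
  · left; refine ⟨?_, ?_, Or.inr ⟨?_, ?_⟩⟩ <;> linarith
  · left; refine ⟨?_, ?_, Or.inl ⟨?_, ?_⟩⟩ <;> linarith

theorem apex_of_isoscelesForm_eq {A B s t : ℝ} (hB : 0 < B) (hBA : B < 4 * A)
    (hst : s + t ≤ 1)
    (h₁ : isoscelesForm A B (s - 1) t = A) (h₂ : isoscelesForm A B s (t - 1) = A) :
    s = 0 ∧ t = 0 := by
  unfold isoscelesForm at h₁ h₂
  obtain rfl : s = t := mul_left_cancel₀ hB.ne' (by linear_combination h₂ - h₁)
  have h : (4 * A - B) * (s * (s - 1)) = 0 := by linear_combination h₁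
  rcases mul_eq_zero.1 h with h | h
  · linarith
  · rcases mul_eq_zero.1 h with h | h
    · exact ⟨h, h⟩
    · linarith

/-- Three points of an isosceles, non-equilateral triangle whose mutual distances are those of its
vertices are the vertices, up to exchanging the endpoints of the base. -/
theorem vertices_of_dist_eq {E : Type*} [NormedAddCommGroup E] [InnerProductSpace ℝ E]
    {p q r x y z : E} (h : dist p q = dist p r) (hne : dist p q ≠ dist q r) (hqr : 0 < dist q r)
    (hlt : dist q r < 2 * dist p q)
    (hx : x ∈ convexHull ℝ {p, q, r}) (hy : y ∈ convexHull ℝ {p, q, r})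
    (hz : z ∈ convexHull ℝ {p, q, r})
    (hxy : dist x y = dist p q) (hxz : dist x z = dist p r) (hyz : dist y z = dist q r) :
    x = p ∧ (y = q ∧ z = r ∨ y = r ∧ z = q) := by
  obtain ⟨s₁, t₁, hs₁, ht₁, hst₁, rfl⟩ := mem_convexHull_triple hx
  obtain ⟨s₂, t₂, hs₂, ht₂, hst₂, rfl⟩ := mem_convexHull_triple hy
  obtain ⟨s₃, t₃, hs₃, ht₃, hst₃, rfl⟩ := mem_convexHull_triple hz
  have h12 := dist_sq_eq_isoscelesForm h s₁ t₁ s₂ t₂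
  have h13 := dist_sq_eq_isoscelesForm h s₁ t₁ s₃ t₃
  have h23 := dist_sq_eq_isoscelesForm h s₂ t₂ s₃ t₃
  rw [hxy] at h12
  rw [hxz, ← h] at h13
  rw [hyz] at h23
  have hpq : 0 < dist p q := by linarith
  have hB : 0 < dist q r ^ 2 := by positivity
  have hA : 0 < dist p q ^ 2 := by positivity
  have hBA : dist q r ^ 2 < 4 * dist p q ^ 2 := by nlinarith
  rcases hne.lt_or_gt with hlt | hlt
  · have hAB : dist p q ^ 2 < dist q r ^ 2 := by gcongr
    rcases endpoints_of_isoscelesForm_eq_base hA hAB hs₂ ht₂ hst₂ hs₃ ht₃ hst₃ h23.symm with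
      ⟨rfl, rfl, rfl, rfl⟩ | ⟨rfl, rfl, rfl, rfl⟩
    · rw [sub_zero] at h12 h13
      obtain ⟨rfl, rfl⟩ := apex_of_isoscelesForm_eq hB hBA hst₁ h12.symm h13.symm
      simp
    · rw [sub_zero] at h12 h13
      obtain ⟨rfl, rfl⟩ := apex_of_isoscelesForm_eq hB hBA hst₁ h13.symm h12.symm
      simp
  · have hAB : dist q r ^ 2 < dist p q ^ 2 := by gcongr
    have hne23 : ¬ (s₂ = s₃ ∧ t₂ = t₃) := by
      rintro ⟨rfl, rfl⟩
      simp [isoscelesForm] at h23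
      simp [h23] at hqr
    have e2 := endpoints_of_isoscelesForm_eq_leg hB hAB hs₁ ht₁ hst₁ hs₂ ht₂ hst₂ h12.symm
    have e3 := endpoints_of_isoscelesForm_eq_leg hB hAB hs₁ ht₁ hst₁ hs₃ ht₃ hst₃ h13.symm
    have key : (s₁ = 0 ∧ t₁ = 0) ∧ ((s₂ = 1 ∧ t₂ = 0) ∧ (s₃ = 0 ∧ t₃ = 1) ∨
        (s₂ = 0 ∧ t₂ = 1) ∧ (s₃ = 1 ∧ t₃ = 0)) := by grind
    obtain ⟨⟨rfl, rfl⟩, ⟨⟨rfl, rfl⟩, ⟨rfl, rfl⟩⟩ | ⟨⟨rfl, rfl⟩, ⟨rfl, rfl⟩⟩⟩ := key <;> simp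

/-- A point of an isosceles triangle is determined by its distances to the vertices. -/
theorem eq_of_dist_vertices_eq {E : Type*} [NormedAddCommGroup E] [InnerProductSpace ℝ E]
    {p q r x y : E} (h : dist p q = dist p r) (hqr : 0 < dist q r)
    (hlt : dist q r < 2 * dist p q)
    (hx : x ∈ convexHull ℝ {p, q, r}) (hy : y ∈ convexHull ℝ {p, q, r})
    (hp : dist x p = dist y p) (hq : dist x q = dist y q) (hr : dist x r = dist y r) : x = y := by
  obtain ⟨s, t, -, -, -, rfl⟩ := mem_convexHull_triple hx
  obtain ⟨s', t', -, -, -, rfl⟩ := mem_convexHull_triple hy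
  have hp' : p = p + (0 : ℝ) • (q - p) + (0 : ℝ) • (r - p) := by module
  have hq' : q = p + (1 : ℝ) • (q - p) + (0 : ℝ) • (r - p) := by module
  have hr' : r = p + (0 : ℝ) • (q - p) + (1 : ℝ) • (r - p) := by module
  have key {σ τ : ℝ} {w : E} (hw : w = p + σ • (q - p) + τ • (r - p))
      (hd : dist (p + s • (q - p) + t • (r - p)) w = dist (p + s' • (q - p) + t' • (r - p)) w) :
      isoscelesForm (dist p q ^ 2) (dist q r ^ 2) (s - σ) (t - τ) =
        isoscelesForm (dist p q ^ 2) (dist q r ^ 2) (s' - σ) (t' - τ) := by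
    rw [← dist_sq_eq_isoscelesForm h, ← dist_sq_eq_isoscelesForm h, ← hw, hd]
  have hB : 0 < dist q r ^ 2 := by positivity
  have hBA : dist q r ^ 2 < 4 * dist p q ^ 2 := by nlinarith
  obtain ⟨rfl, rfl⟩ := eq_of_isoscelesForm_eq hB hBA
    (by simpa using key hp' hp) (by simpa using key hq' hq) (by simpa using key hr' hr)
  rfl

/-- An isosceles, non-equilateral triangle in the Euclidean plane has exactly 2
isometries. -/
theorem isosceles_triangle_two_isometries
    (p₁ p₂ p₃ : EuclideanSpace ℝ (Fin 2))
    (hncol : ¬ Collinear ℝ ({p₁, p₂, p₃} : Set (EuclideanSpace ℝ (Fin 2))))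
    (hiso : dist p₁ p₂ = dist p₁ p₃) (hne : dist p₁ p₂ ≠ dist p₂ p₃) :
    Nat.card {g : (convexHull ℝ {p₁, p₂, p₃} : Set (EuclideanSpace ℝ (Fin 2))) →
                  (convexHull ℝ {p₁, p₂, p₃} : Set (EuclideanSpace ℝ (Fin 2))) //
        ∀ x y, dist (g x) (g y) = dist x y} = 2 := by
  have hpos : 0 < dist p₂ p₃ := by
    refine dist_pos.2 fun h => hncol ?_
    subst h
    simpa using collinear_pair ℝ p₁ p₂
  have hlt : dist p₂ p₃ < 2 * dist p₁ p₂ := by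
    have htri := dist_triangle p₂ p₁ p₃
    rw [dist_comm p₂ p₁] at htri
    refine lt_of_le_of_ne (by linarith) fun h => hncol ?_
    have hw : Wbtw ℝ p₂ p₁ p₃ := by
      rw [← dist_add_dist_eq_iff, dist_comm p₂ p₁]
      linarith
    have := hw.collinear
    rwa [Set.insert_comm] at this
  have m₁ : p₁ ∈ convexHull ℝ {p₁, p₂, p₃} := subset_convexHull ℝ _ (by simp)
  have m₂ : p₂ ∈ convexHull ℝ {p₁, p₂, p₃} := subset_convexHull ℝ _ (by simp)
  have m₃ : p₃ ∈ convexHull ℝ {p₁, p₂, p₃} := subset_convexHull ℝ _ (by simp)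
  obtain ⟨F, hF₁, hF₂, hF₃⟩ := exists_affineIsometryEquiv_swap hiso
  have hF : Set.MapsTo F (convexHull ℝ {p₁, p₂, p₃}) (convexHull ℝ {p₁, p₂, p₃}) := by
    have him : F '' convexHull ℝ {p₁, p₂, p₃} = convexHull ℝ (F '' {p₁, p₂, p₃}) :=
      F.toAffineEquiv.toAffineMap.image_convexHull _
    rw [Set.mapsTo_iff_image_subset, him, Set.image_insert_eq, Set.image_pair, hF₁, hF₂, hF₃,
      Set.pair_comm]
  rw [Nat.card_eq_two_iff]
  refine ⟨⟨id, fun _ _ => rfl⟩, ⟨hF.restrict, fun x y => F.dist_map x y⟩, ?_, ?_⟩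
  · intro h
    have h2 : p₂ = F p₂ := congrArg Subtype.val (congrFun (congrArg Subtype.val h) ⟨p₂, m₂⟩)
    rw [hF₂] at h2
    exact dist_pos.1 hpos h2
  · refine Set.eq_univ_of_forall fun ⟨g, hg⟩ => ?_
    have hg' (x y) : dist (g x : EuclideanSpace ℝ (Fin 2)) (g y) =
        dist (x : EuclideanSpace ℝ (Fin 2)) y := hg x y
    obtain ⟨h₁, ⟨h₂, h₃⟩ | ⟨h₂, h₃⟩⟩ := vertices_of_dist_eq hiso hne hpos hlt
      (g ⟨p₁, m₁⟩).2 (g ⟨p₂, m₂⟩).2 (g ⟨p₃, m₃⟩).2 (hg' _ _) (hg' _ _) (hg' _ _)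
    · refine Or.inl (Subtype.ext (funext fun x => Subtype.ext ?_))
      refine eq_of_dist_vertices_eq hiso hpos hlt (g x).2 x.2 ?_ ?_ ?_
      · simpa [h₁] using hg' x ⟨p₁, m₁⟩
      · simpa [h₂] using hg' x ⟨p₂, m₂⟩
      · simpa [h₃] using hg' x ⟨p₃, m₃⟩
    · refine Or.inr (Subtype.ext (funext fun x => Subtype.ext ?_))
      refine eq_of_dist_vertices_eq hiso hpos hlt (g x).2 (hF x.2) ?_ ?_ ?_
      · simpa [h₁, hF₁] using (hg' x ⟨p₁, m₁⟩).trans (F.dist_map x p₁).symm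
      · simpa [h₃, hF₃] using (hg' x ⟨p₃, m₃⟩).trans (F.dist_map x p₃).symm
      · simpa [h₂, hF₂] using (hg' x ⟨p₂, m₂⟩).trans (F.dist_map x p₂).symm
end

section
/- Let p₁, p₂, p₃ be three non-collinear points of the Euclidean plane ℝ² and let T be the convex hull of {p₁, p₂, p₃}. Then every isometry of T, i.e. every map g : T → T satisfying d(g(x), g(y)) = d(x, y) for all x, y ∈ T, maps the vertex set {p₁, p₂, p₃} into itself. -/
open Set

/-- A distance-preserving self-map of a compact metric space is surjective. -/
theorem Isometry.surjective_of_compactSpace {X : Type*} [MetricSpace X] [CompactSpace X]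
    {f : X → X} (hf : Isometry f) : Function.Surjective f := by
  by_contra hsurj
  obtain ⟨y, hy⟩ : ∃ y, y ∉ range f := by simpa [Function.Surjective] using hsurj
  obtain ⟨ε, hε, hball⟩ := Metric.isOpen_iff.1
    (isCompact_range hf.continuous).isClosed.isOpen_compl y hy
  have hdist_iterate (n : ℕ) (a b : X) : dist (f^[n] a) (f^[n] b) = dist a b := by
    induction n generalizing a b with
    | zero => rfl
    | succ n ih => rw [Function.iterate_succ_apply, Function.iterate_succ_apply, ih, hf.dist_eq]
  have hsep (m n : ℕ) (hmn : m < n) : ε ≤ dist (f^[n] y) (f^[m] y) := by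
    obtain ⟨k, rfl⟩ := Nat.exists_eq_add_of_lt hmn
    rw [add_assoc, Function.iterate_add_apply, hdist_iterate, Function.iterate_succ_apply']
    by_contra! hlt
    exact hball (Metric.mem_ball.2 hlt) (mem_range_self _)
  obtain ⟨a, φ, hφ, hlim⟩ := CompactSpace.tendsto_subseq fun n => f^[n] y
  obtain ⟨N, hN⟩ := Metric.cauchySeq_iff.1 hlim.cauchySeq ε hε
  exact (hN (N + 1) N.le_succ N le_rfl).not_ge (hsep _ _ (hφ N.lt_succ_self))

/-- Each point of a finite affinely independent set is an extreme point of its convex hull. -/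
theorem AffineIndependent.subset_extremePoints_convexHull {E : Type*} [NormedAddCommGroup E]
    [NormedSpace ℝ E] {s : Set E} (hs : AffineIndependent ℝ ((↑) : s → E))
    (hfin : s.Finite) : s ⊆ (convexHull ℝ s).extremePoints ℝ := by
  intro p hp
  by_contra hext
  have hsub : (convexHull ℝ s).extremePoints ℝ ⊆ s \ {p} := fun q hq =>
    ⟨extremePoints_convexHull_subset hq, fun hqp => hext (hqp ▸ hq)⟩
  have hmem : p ∈ closure (convexHull ℝ ((convexHull ℝ s).extremePoints ℝ)) := by
    rw [closure_convexHull_extremePoints (hfin.isCompact_convexHull ℝ) (convex_convexHull ℝ s)]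
    exact subset_convexHull ℝ s hp
  have hmem' : p ∈ convexHull ℝ (s \ {p}) :=
    closure_minimal (convexHull_mono hsub) (hfin.sdiff.isClosed_convexHull ℝ) hmem
  refine hs.notMem_affineSpan_sdiff ⟨p, hp⟩ univ ?_
  have himage : image ((↑) : s → E) (univ \ {⟨p, hp⟩}) = s \ {p} := by
    simp [image_sdiff Subtype.val_injective]
  rw [himage]
  exact convexHull_subset_affineSpan _ hmem'

/-- A surjective isometry of a subset of a strictly convex space preserves its extreme points. -/
theorem Isometry.map_mem_extremePoints {E : Type*} [NormedAddCommGroup E] [NormedSpace ℝ E]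
    [StrictConvexSpace ℝ E] {s : Set E} {f : s → s} (hf : Isometry f)
    (hsurj : Function.Surjective f) {x : s} (hx : (x : E) ∈ s.extremePoints ℝ) :
    (f x : E) ∈ s.extremePoints ℝ := by
  rw [mem_extremePoints_iff_forall_segment] at hx ⊢
  refine ⟨(f x).2, fun a ha b hb hseg => ?_⟩
  obtain ⟨a', ha'⟩ := hsurj ⟨a, ha⟩
  obtain ⟨b', hb'⟩ := hsurj ⟨b, hb⟩
  obtain rfl : (f a' : E) = a := congrArg Subtype.val ha'
  obtain rfl : (f b' : E) = b := congrArg Subtype.val hb'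
  rw [mem_segment_iff_wbtw, ← dist_add_dist_eq_iff] at hseg
  simp only [← Subtype.dist_eq, hf.dist_eq] at hseg
  have hseg' : (x : E) ∈ segment ℝ (a' : E) b' :=
    mem_segment_iff_wbtw.2 (dist_add_dist_eq_iff.1 hseg)
  exact (hx.2 a' a'.2 b' b'.2 hseg').imp
    (fun h => by rw [Subtype.ext h]) (fun h => by rw [Subtype.ext h])

/-- Every isometry of a triangle in the Euclidean plane maps the vertex set into
itself. -/
theorem triangle_isometry_maps_vertices_to_vertices
    (p₁ p₂ p₃ : EuclideanSpace ℝ (Fin 2))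
    (hncol : ¬ Collinear ℝ ({p₁, p₂, p₃} : Set (EuclideanSpace ℝ (Fin 2))))
    (g : (convexHull ℝ {p₁, p₂, p₃} : Set (EuclideanSpace ℝ (Fin 2))) →
         (convexHull ℝ {p₁, p₂, p₃} : Set (EuclideanSpace ℝ (Fin 2))))
    (hg : ∀ x y, dist (g x) (g y) = dist x y) :
    ∀ x : (convexHull ℝ {p₁, p₂, p₃} : Set (EuclideanSpace ℝ (Fin 2))),
      (x : EuclideanSpace ℝ (Fin 2)) ∈ ({p₁, p₂, p₃} : Set (EuclideanSpace ℝ (Fin 2))) →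
      ((g x : EuclideanSpace ℝ (Fin 2)) ∈ ({p₁, p₂, p₃} : Set (EuclideanSpace ℝ (Fin 2)))) := by
  intro x hx
  have hind : AffineIndependent ℝ
      ((↑) : ({p₁, p₂, p₃} : Set (EuclideanSpace ℝ (Fin 2))) → EuclideanSpace ℝ (Fin 2)) := by
    have hrange : range ![p₁, p₂, p₃] = {p₁, p₂, p₃} := by
      simp only [Matrix.range_cons, Matrix.range_empty, singleton_union, insert_empty_eq]
    exact hrange ▸ (affineIndependent_iff_not_collinear_set.2 hncol).range
  have hfin : ({p₁, p₂, p₃} : Set (EuclideanSpace ℝ (Fin 2))).Finite := toFinite _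
  have := isCompact_iff_compactSpace.1 (hfin.isCompact_convexHull ℝ)
  have hiso : Isometry g := Isometry.of_dist_eq hg
  exact extremePoints_convexHull_subset (hiso.map_mem_extremePoints
    hiso.surjective_of_compactSpace (hind.subset_extremePoints_convexHull hfin hx))
end
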